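/- arXiv:1703.06469 — 9 statements merged into one kernel-verified Lean document; each statement's English description precedes it below -/
import Mathlib

section
/- Let E = (X, H, Y, i, j, J) be a para-Hilbert space and let P : E → E be a morphism with P ∘ P = P (componentwise, i.e. P_X ∘ P_X = P_X, P_H ∘ P_H = P_H, P_Y ∘ P_Y = P_Y). Then i maps the range of P_X into the range of P_H with dense image (i.e. i(range P_X) is dense in range P_H), and j maps the range of P_H into the range of P_Y with dense image (i.e. j(range P_H) is dense in range P_Y). -/
open scoped RealInnerProductSpace

/-- A para-Hilbert space structure on the triple `(X, H, Y)`: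
`i : X → H` and `j : H → Y` are injective continuous linear maps with dense range,
`J : X ≃ Y*` is an isomorphism of Banach spaces, and the compatibility condition
`j* ∘ J = I ∘ i` (with `I` the Riesz isomorphism of `H`) holds. -/
structure ParaHilbert (X H Y : Type*)
    [NormedAddCommGroup X] [NormedSpace ℝ X]
    [NormedAddCommGroup H] [InnerProductSpace ℝ H]
    [NormedAddCommGroup Y] [NormedSpace ℝ Y] where
  i : X →L[ℝ] H
  j : H →L[ℝ] Y
  i_inj : Function.Injective i
  j_inj : Function.Injective j
  i_dense : DenseRange i
  j_dense : DenseRange j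
  J : X ≃L[ℝ] (Y →L[ℝ] ℝ)
  compat : ∀ (x : X) (v : H), J x (j v) = ⟪i x, v⟫

section Defs

variable {X₁ H₁ Y₁ X₂ H₂ Y₂ X₃ H₃ Y₃ : Type*}
  [NormedAddCommGroup X₁] [NormedSpace ℝ X₁]
  [NormedAddCommGroup H₁] [InnerProductSpace ℝ H₁]
  [NormedAddCommGroup Y₁] [NormedSpace ℝ Y₁]
  [NormedAddCommGroup X₂] [NormedSpace ℝ X₂]
  [NormedAddCommGroup H₂] [InnerProductSpace ℝ H₂]
  [NormedAddCommGroup Y₂] [NormedSpace ℝ Y₂]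
  [NormedAddCommGroup X₃] [NormedSpace ℝ X₃]
  [NormedAddCommGroup H₃] [InnerProductSpace ℝ H₃]
  [NormedAddCommGroup Y₃] [NormedSpace ℝ Y₃]

/-- A morphism of para-Hilbert spaces: a continuous linear chain map. -/
structure ParaHilbert.Hom (E₁ : ParaHilbert X₁ H₁ Y₁) (E₂ : ParaHilbert X₂ H₂ Y₂) where
  AX : X₁ →L[ℝ] X₂
  AH : H₁ →L[ℝ] H₂
  AY : Y₁ →L[ℝ] Y₂
  comm_i : ∀ x : X₁, E₂.i (AX x) = AH (E₁.i x)
  comm_j : ∀ v : H₁, E₂.j (AH v) = AY (E₁.j v)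

variable {E₁ : ParaHilbert X₁ H₁ Y₁} {E₂ : ParaHilbert X₂ H₂ Y₂} {E₃ : ParaHilbert X₃ H₃ Y₃}

/-- Composition of morphisms of para-Hilbert spaces (componentwise). -/
def ParaHilbert.Hom.comp (A : E₂.Hom E₃) (B : E₁.Hom E₂) : E₁.Hom E₃ where
  AX := A.AX.comp B.AX
  AH := A.AH.comp B.AH
  AY := A.AY.comp B.AY
  comm_i x := by simp only [ContinuousLinearMap.comp_apply, A.comm_i, B.comm_i]
  comm_j v := by simp only [ContinuousLinearMap.comp_apply, A.comm_j, B.comm_j]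

/-- The identity morphism of a para-Hilbert space. -/
def ParaHilbert.Hom.id (E : ParaHilbert X₁ H₁ Y₁) : E.Hom E where
  AX := ContinuousLinearMap.id ℝ X₁
  AH := ContinuousLinearMap.id ℝ H₁
  AY := ContinuousLinearMap.id ℝ Y₁
  comm_i _ := rfl
  comm_j _ := rfl

/-- `B` is a generalized inverse of `A`: `A B A = A` and `B A B = B`. -/
def ParaHilbert.IsGeneralizedInverse (A : E₁.Hom E₂) (B : E₂.Hom E₁) : Prop :=
  A.comp (B.comp A) = A ∧ B.comp (A.comp B) = B

/-- Self-adjointness of a continuous operator on an inner product space. -/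
def IsSelfAdjointOp {H : Type*} [NormedAddCommGroup H] [InnerProductSpace ℝ H]
    (T : H →L[ℝ] H) : Prop :=
  ∀ v w : H, ⟪T v, w⟫ = ⟪v, T w⟫

/-- `B` is a pseudoinverse of `A`: a generalized inverse such that `A_H ∘ B_H` and
`B_H ∘ A_H` are self-adjoint. -/
def ParaHilbert.IsPseudoinverse (A : E₁.Hom E₂) (B : E₂.Hom E₁) : Prop :=
  ParaHilbert.IsGeneralizedInverse A B ∧
    IsSelfAdjointOp (A.AH.comp B.AH) ∧ IsSelfAdjointOp (B.AH.comp A.AH)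

/-- `A'` is the adjoint morphism of `A`:
`A'_X = J₁⁻¹ ∘ (A_Y)ᵗ ∘ J₂` (i.e. `J₁ (A'_X u) = (J₂ u) ∘ A_Y`),
`A'_H` is the Hilbert space adjoint of `A_H`, and
`A'_Y = K₁⁻¹ ∘ (A_X)ᵗ ∘ K₂` (i.e. `K₁ (A'_Y w) = (K₂ w) ∘ A_X`, where `K x' = (x ↦ J x x')`). -/
def ParaHilbert.IsAdjointPair (A : E₁.Hom E₂) (A' : E₂.Hom E₁) : Prop :=
  (∀ u : X₂, E₁.J (A'.AX u) = (E₂.J u).comp A.AY) ∧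
  (∀ (v : H₂) (w : H₁), ⟪A'.AH v, w⟫ = ⟪v, A.AH w⟫) ∧
  (∀ (w : Y₂) (x : X₁), E₁.J x (A'.AY w) = E₂.J (A.AX x) w)

/-- A real normed space is reflexive if the canonical inclusion into its double dual
is surjective. -/
def ReflexiveBanach (Y : Type*) [NormedAddCommGroup Y] [NormedSpace ℝ Y] : Prop :=
  Function.Surjective (NormedSpace.inclusionInDoubleDual ℝ Y)

/-- The transpose (Banach space adjoint) of a continuous linear map. -/
noncomputable def transposeCLM {E F : Type*} [NormedAddCommGroup E] [NormedSpace ℝ E]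
    [NormedAddCommGroup F] [NormedSpace ℝ F] (A : E →L[ℝ] F) :
    (F →L[ℝ] ℝ) →L[ℝ] (E →L[ℝ] ℝ) :=
  (ContinuousLinearMap.compL ℝ E F ℝ).flip A

end Defs

/-- If `g ∘ S = T ∘ g` and `g` has dense range, then `g` maps the range of `S` into the range of
the continuous map `T`, with dense image. -/
theorem DenseRange.image_range_of_semiconj {α β : Type*} [TopologicalSpace β]
    {g : α → β} {S : α → α} {T : β → β} (hg : DenseRange g) (hT : Continuous T)
    (h : Function.Semiconj g S T) :
    g '' Set.range S ⊆ Set.range T ∧ Set.range T ⊆ closure (g '' Set.range S) := by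
  have himage : g '' Set.range S = T '' Set.range g := by
    rw [← Set.range_comp, ← Set.range_comp, h.comp_eq]
  rw [himage]
  exact ⟨Set.image_subset_range T _, hT.range_subset_closure_image_dense hg⟩

section Statements

variable {X₁ H₁ Y₁ X₂ H₂ Y₂ : Type*}
  [NormedAddCommGroup X₁] [NormedSpace ℝ X₁] [CompleteSpace X₁]
  [NormedAddCommGroup H₁] [InnerProductSpace ℝ H₁] [CompleteSpace H₁]
  [NormedAddCommGroup Y₁] [NormedSpace ℝ Y₁] [CompleteSpace Y₁]
  [NormedAddCommGroup X₂] [NormedSpace ℝ X₂] [CompleteSpace X₂]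
  [NormedAddCommGroup H₂] [InnerProductSpace ℝ H₂] [CompleteSpace H₂]
  [NormedAddCommGroup Y₂] [NormedSpace ℝ Y₂] [CompleteSpace Y₂]

/-- If `P : E → E` is an idempotent morphism of the para-Hilbert space `E`, then `i` maps
the range of `P_X` into the range of `P_H` with dense image, and `j` maps the range of
`P_H` into the range of `P_Y` with dense image. -/
theorem statement1 (E : ParaHilbert X₁ H₁ Y₁) (P : E.Hom E)
    (hPX : P.AX.comp P.AX = P.AX) (hPH : P.AH.comp P.AH = P.AH)
    (hPY : P.AY.comp P.AY = P.AY) :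
    (⇑E.i '' Set.range ⇑P.AX ⊆ Set.range ⇑P.AH ∧
      Set.range ⇑P.AH ⊆ closure (⇑E.i '' Set.range ⇑P.AX)) ∧
    (⇑E.j '' Set.range ⇑P.AH ⊆ Set.range ⇑P.AY ∧
      Set.range ⇑P.AY ⊆ closure (⇑E.j '' Set.range ⇑P.AH)) := by
  exact ⟨E.i_dense.image_range_of_semiconj P.AH.continuous P.comm_i,
    E.j_dense.image_range_of_semiconj P.AY.continuous P.comm_j⟩

end Statements
end

section
/- Let A : E₁ → E₂ be a morphism of para-Hilbert spaces. Define A_X* := J₁⁻¹ ∘ (A_Y)ᵗ ∘ J₂, where (A_Y)ᵗ : Y₂* → Y₁* is the transpose of A_Y. Then A_X* is a continuous linear operator from X₂ to X₁ and it satisfies g₁(A_X* u₂, u₁) = g₂(u₂, A_X u₁) for all u₁ ∈ X₁ and u₂ ∈ X₂, where g_k(x, x') := ⟨i_k x, i_k x'⟩_{H_k} denotes the pre-Hilbert pairing of E_k. -/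
open scoped RealInnerProductSpace

section Statements

variable {X₁ H₁ Y₁ X₂ H₂ Y₂ : Type*}
  [NormedAddCommGroup X₁] [NormedSpace ℝ X₁] [CompleteSpace X₁]
  [NormedAddCommGroup H₁] [InnerProductSpace ℝ H₁] [CompleteSpace H₁]
  [NormedAddCommGroup Y₁] [NormedSpace ℝ Y₁] [CompleteSpace Y₁]
  [NormedAddCommGroup X₂] [NormedSpace ℝ X₂] [CompleteSpace X₂]
  [NormedAddCommGroup H₂] [InnerProductSpace ℝ H₂] [CompleteSpace H₂]
  [NormedAddCommGroup Y₂] [NormedSpace ℝ Y₂] [CompleteSpace Y₂]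

variable {E₁ : ParaHilbert X₁ H₁ Y₁} {E₂ : ParaHilbert X₂ H₂ Y₂}

/-- The adjoint `A_X* := J₁⁻¹ ∘ (A_Y)ᵗ ∘ J₂` of the `X`-component of a morphism `A`,
as a continuous linear operator from `X₂` to `X₁`. -/
noncomputable def adjX (A : E₁.Hom E₂) : X₂ →L[ℝ] X₁ :=
  ((E₁.J.symm : (Y₁ →L[ℝ] ℝ) →L[ℝ] X₁).comp (transposeCLM A.AY)).comp
    (E₂.J : X₂ →L[ℝ] (Y₂ →L[ℝ] ℝ))

/-- The adjoint `A_X* = J₁⁻¹ ∘ (A_Y)ᵗ ∘ J₂` is a continuous linear operator from `X₂`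
to `X₁` and satisfies `g₁(A_X* u₂, u₁) = g₂(u₂, A_X u₁)` for all `u₁ ∈ X₁`, `u₂ ∈ X₂`,
where `g_k` denotes the pre-Hilbert pairing of `E_k`. -/
theorem statement4 (A : E₁.Hom E₂) :
    (∀ u₂ : X₂, adjX A u₂ = E₁.J.symm ((E₂.J u₂).comp A.AY)) ∧
    (∀ (u₁ : X₁) (u₂ : X₂),
      ⟪E₁.i (adjX A u₂), E₁.i u₁⟫ = ⟪E₂.i u₂, E₂.i (A.AX u₁)⟫) := by
  have adjX_apply (u₂ : X₂) : adjX A u₂ = E₁.J.symm ((E₂.J u₂).comp A.AY) := rfl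
  refine ⟨adjX_apply, fun u₁ u₂ => ?_⟩
  rw [← E₁.compat, adjX_apply, E₁.J.apply_symm_apply, ContinuousLinearMap.comp_apply,
    ← A.comm_j, E₂.compat, A.comm_i]

end Statements
end

section
/- Let E = (X, H, Y, i, j, J) be a reflexive para-Hilbert space. Denote by Ψ_X : X → X** and Ψ_Y : Y → Y** the canonical embeddings into the biduals. Then K := Jᵗ ∘ Ψ_Y : Y → X* (where Jᵗ : Y** → X* is the transpose of J) is the unique isomorphism of Banach spaces from Y to X* making the diagram commute in the sense that K ∘ j = iᵗ ∘ I, where iᵗ : H* → X* is the transpose of i and I : H → H* is the Riesz isomorphism. Moreover, Kᵗ ∘ Ψ_X = J, where Kᵗ : X** → Y* is the transpose of K. -/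
open scoped RealInnerProductSpace

section Statements

variable {X₁ H₁ Y₁ X₂ H₂ Y₂ : Type*}
  [NormedAddCommGroup X₁] [NormedSpace ℝ X₁] [CompleteSpace X₁]
  [NormedAddCommGroup H₁] [InnerProductSpace ℝ H₁] [CompleteSpace H₁]
  [NormedAddCommGroup Y₁] [NormedSpace ℝ Y₁] [CompleteSpace Y₁]
  [NormedAddCommGroup X₂] [NormedSpace ℝ X₂] [CompleteSpace X₂]
  [NormedAddCommGroup H₂] [InnerProductSpace ℝ H₂] [CompleteSpace H₂]
  [NormedAddCommGroup Y₂] [NormedSpace ℝ Y₂] [CompleteSpace Y₂]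

/-- The operator `K := Jᵗ ∘ Ψ_Y : Y → X*`, where `Ψ_Y : Y → Y**` is the canonical
embedding into the double dual and `Jᵗ : Y** → X*` is the transpose of `J`. -/
noncomputable def Kmap (E : ParaHilbert X₁ H₁ Y₁) : Y₁ →L[ℝ] (X₁ →L[ℝ] ℝ) :=
  (transposeCLM (E.J : X₁ →L[ℝ] (Y₁ →L[ℝ] ℝ))).comp (NormedSpace.inclusionInDoubleDual ℝ Y₁)

/-- For a reflexive para-Hilbert space `E`, the operator `K = Jᵗ ∘ Ψ_Y : Y → X*` is the
unique isomorphism of Banach spaces satisfying `K ∘ j = iᵗ ∘ I`; moreover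
`Kᵗ ∘ Ψ_X = J`. -/
theorem statement5 (E : ParaHilbert X₁ H₁ Y₁)
    (hrefl : ReflexiveBanach Y₁) :
    Function.Bijective (Kmap E) ∧
    (∀ (v : H₁) (x : X₁), Kmap E (E.j v) x = ⟪v, E.i x⟫) ∧
    (∀ K' : Y₁ →L[ℝ] (X₁ →L[ℝ] ℝ), Function.Bijective K' →
      (∀ (v : H₁) (x : X₁), K' (E.j v) x = ⟪v, E.i x⟫) → K' = Kmap E) ∧
    (∀ (x : X₁) (w : Y₁),
      transposeCLM (Kmap E) (NormedSpace.inclusionInDoubleDual ℝ X₁ x) w = E.J x w) := by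
  have hK : ∀ (y : Y₁) (x : X₁), Kmap E y x = E.J x y := fun _ _ => rfl
  have hj : ∀ (v : H₁) (x : X₁), Kmap E (E.j v) x = ⟪v, E.i x⟫ := fun v x => by
    rw [hK, E.compat, real_inner_comm]
  refine ⟨⟨fun y z hyz => ?_, fun f => ?_⟩, hj, fun K' _ hK' => ?_, fun _ _ => rfl⟩
  · refine (NormedSpace.inclusionInDoubleDualLi ℝ (E := Y₁)).injective
      (ContinuousLinearMap.ext fun g => ?_)
    obtain ⟨x, rfl⟩ := E.J.surjective g
    exact DFunLike.congr_fun hyz x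
  · obtain ⟨y, hy⟩ := hrefl (f.comp (E.J.symm : (Y₁ →L[ℝ] ℝ) →L[ℝ] X₁))
    refine ⟨y, ContinuousLinearMap.ext fun x => ?_⟩
    rw [hK]
    simpa using DFunLike.congr_fun hy (E.J x)
  · refine DFunLike.coe_injective (E.j_dense.equalizer K'.continuous (Kmap E).continuous ?_)
    exact funext fun v => ContinuousLinearMap.ext fun x => (hK' v x).trans (hj v x).symm

end Statements
end

section
/- Let A : E₁ → E₂ be a morphism of para-Hilbert spaces. If B : E₂ → E₁ and C : E₂ → E₁ are both pseudoinverses of A, then B = C (componentwise). -/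
open scoped RealInnerProductSpace

section Helpers

variable {H : Type*} [NormedAddCommGroup H] [InnerProductSpace ℝ H]

/-- Self-adjoint operators `P`, `Q` with `P Q = Q` and `Q P = P` are equal. -/
theorem IsSelfAdjointOp.eq_of_apply_eq_right {P Q : H →L[ℝ] H}
    (hP : IsSelfAdjointOp P) (hQ : IsSelfAdjointOp Q)
    (hPQ : ∀ v, P (Q v) = Q v) (hQP : ∀ v, Q (P v) = P v) : P = Q := by
  ext v
  refine ext_inner_right ℝ fun w => ?_
  rw [← hQP v, hQ, hP, hPQ, ← hQ]

/-- Self-adjoint operators `P`, `Q` with `P Q = P` and `Q P = Q` are equal. -/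
theorem IsSelfAdjointOp.eq_of_apply_eq_left {P Q : H →L[ℝ] H}
    (hP : IsSelfAdjointOp P) (hQ : IsSelfAdjointOp Q)
    (hPQ : ∀ v, P (Q v) = P v) (hQP : ∀ v, Q (P v) = Q v) : P = Q := by
  ext v
  refine ext_inner_right ℝ fun w => ?_
  rw [← hPQ v, hP, hQ, hQP, ← hQ]

end Helpers

section Hom

variable {X₁ H₁ Y₁ X₂ H₂ Y₂ : Type*}
  [NormedAddCommGroup X₁] [NormedSpace ℝ X₁]
  [NormedAddCommGroup H₁] [InnerProductSpace ℝ H₁]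
  [NormedAddCommGroup Y₁] [NormedSpace ℝ Y₁]
  [NormedAddCommGroup X₂] [NormedSpace ℝ X₂]
  [NormedAddCommGroup H₂] [InnerProductSpace ℝ H₂]
  [NormedAddCommGroup Y₂] [NormedSpace ℝ Y₂]
  {E₁ : ParaHilbert X₁ H₁ Y₁} {E₂ : ParaHilbert X₂ H₂ Y₂}

/-- A morphism of para-Hilbert spaces is determined by its Hilbert space component. -/
theorem ParaHilbert.Hom.eq_of_AH_eq {B C : E₁.Hom E₂} (h : B.AH = C.AH) :
    B.AX = C.AX ∧ B.AY = C.AY := by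
  constructor
  · ext x
    exact E₂.i_inj (by rw [B.comm_i, C.comm_i, h])
  · refine DFunLike.coe_injective (E₁.j_dense.equalizer B.AY.continuous C.AY.continuous ?_)
    funext v
    simp only [Function.comp_apply, ← B.comm_j, ← C.comm_j, h]

/-- The Hilbert space component of a pseudoinverse is unique. -/
theorem ParaHilbert.IsPseudoinverse.AH_eq {A : E₁.Hom E₂} {B C : E₂.Hom E₁}
    (hB : ParaHilbert.IsPseudoinverse A B) (hC : ParaHilbert.IsPseudoinverse A C) :
    B.AH = C.AH := by
  obtain ⟨⟨hB₁, hB₂⟩, hAB, hBA⟩ := hB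
  obtain ⟨⟨hC₁, hC₂⟩, hAC, hCA⟩ := hC
  have hABA (v) : A.AH (B.AH (A.AH v)) = A.AH v := congrArg (fun F => F.AH v) hB₁
  have hACA (v) : A.AH (C.AH (A.AH v)) = A.AH v := congrArg (fun F => F.AH v) hC₁
  have hBAB (v) : B.AH (A.AH (B.AH v)) = B.AH v := congrArg (fun F => F.AH v) hB₂
  have hCAC (v) : C.AH (A.AH (C.AH v)) = C.AH v := congrArg (fun F => F.AH v) hC₂
  have hP := hAB.eq_of_apply_eq_right hAC (fun v => hABA (C.AH v)) (fun v => hACA (B.AH v))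
  have hQ := hBA.eq_of_apply_eq_left hCA (fun v => congrArg B.AH (hACA v))
    (fun v => congrArg C.AH (hABA v))
  ext v
  calc B.AH v = B.AH (A.AH (B.AH v)) := (hBAB v).symm
    _ = B.AH (A.AH (C.AH v)) := congrArg B.AH (DFunLike.congr_fun hP v)
    _ = C.AH (A.AH (C.AH v)) := DFunLike.congr_fun hQ (C.AH v)
    _ = C.AH v := hCAC v

end Hom

section Statements

variable {X₁ H₁ Y₁ X₂ H₂ Y₂ : Type*}
  [NormedAddCommGroup X₁] [NormedSpace ℝ X₁] [CompleteSpace X₁]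
  [NormedAddCommGroup H₁] [InnerProductSpace ℝ H₁] [CompleteSpace H₁]
  [NormedAddCommGroup Y₁] [NormedSpace ℝ Y₁] [CompleteSpace Y₁]
  [NormedAddCommGroup X₂] [NormedSpace ℝ X₂] [CompleteSpace X₂]
  [NormedAddCommGroup H₂] [InnerProductSpace ℝ H₂] [CompleteSpace H₂]
  [NormedAddCommGroup Y₂] [NormedSpace ℝ Y₂] [CompleteSpace Y₂]

/-- Uniqueness of the pseudoinverse: if `B` and `C` are both pseudoinverses of the
morphism `A : E₁ → E₂`, then `B = C` componentwise. -/
theorem statement6 (E₁ : ParaHilbert X₁ H₁ Y₁) (E₂ : ParaHilbert X₂ H₂ Y₂)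
    (A : E₁.Hom E₂) (B C : E₂.Hom E₁)
    (hB : ParaHilbert.IsPseudoinverse A B) (hC : ParaHilbert.IsPseudoinverse A C) :
    B.AX = C.AX ∧ B.AH = C.AH ∧ B.AY = C.AY := by
  have h := hB.AH_eq hC
  exact ⟨(ParaHilbert.Hom.eq_of_AH_eq h).1, h, (ParaHilbert.Hom.eq_of_AH_eq h).2⟩

end Statements
end

section
/- Let E₁ and E₂ be reflexive para-Hilbert spaces, let A : E₁ → E₂ be a morphism, and let B : E₂ → E₁ be a generalized inverse of A. Then B is the pseudoinverse of A if and only if (A B)* = A B and (B A)* = B A, where * denotes the adjoint morphism. -/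
open scoped RealInnerProductSpace

/-- An endomorphism of a para-Hilbert space is its own adjoint morphism if and only if its
Hilbert space component is self-adjoint. -/
theorem ParaHilbert.isAdjointPair_self_iff {X H Y : Type*}
    [NormedAddCommGroup X] [NormedSpace ℝ X]
    [NormedAddCommGroup H] [InnerProductSpace ℝ H]
    [NormedAddCommGroup Y] [NormedSpace ℝ Y]
    {E : ParaHilbert X H Y} (T : E.Hom E) :
    ParaHilbert.IsAdjointPair T T ↔ IsSelfAdjointOp T.AH := by
  refine ⟨fun h => h.2.1, fun h => ?_⟩
  have hJ (u : X) : E.J (T.AX u) = (E.J u).comp T.AY := by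
    apply DFunLike.coe_injective
    refine E.j_dense.equalizer (E.J (T.AX u)).continuous ((E.J u).comp T.AY).continuous ?_
    funext v
    simp only [Function.comp_apply, ContinuousLinearMap.comp_apply]
    rw [← T.comm_j, E.compat, E.compat, T.comm_i, h]
  exact ⟨hJ, h, fun w x => by rw [hJ, ContinuousLinearMap.comp_apply]⟩

section Statements

variable {X₁ H₁ Y₁ X₂ H₂ Y₂ : Type*}
  [NormedAddCommGroup X₁] [NormedSpace ℝ X₁] [CompleteSpace X₁]
  [NormedAddCommGroup H₁] [InnerProductSpace ℝ H₁] [CompleteSpace H₁]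
  [NormedAddCommGroup Y₁] [NormedSpace ℝ Y₁] [CompleteSpace Y₁]
  [NormedAddCommGroup X₂] [NormedSpace ℝ X₂] [CompleteSpace X₂]
  [NormedAddCommGroup H₂] [InnerProductSpace ℝ H₂] [CompleteSpace H₂]
  [NormedAddCommGroup Y₂] [NormedSpace ℝ Y₂] [CompleteSpace Y₂]

/-- Let `E₁`, `E₂` be reflexive para-Hilbert spaces and let `B` be a generalized inverse
of the morphism `A : E₁ → E₂`. Then `B` is the pseudoinverse of `A` if and only if the
morphisms `A B` and `B A` are self-adjoint, i.e. `(A B)* = A B` and `(B A)* = B A`. -/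
theorem statement7 (E₁ : ParaHilbert X₁ H₁ Y₁) (E₂ : ParaHilbert X₂ H₂ Y₂)
    (hrefl₁ : ReflexiveBanach Y₁) (hrefl₂ : ReflexiveBanach Y₂)
    (A : E₁.Hom E₂) (B : E₂.Hom E₁)
    (hgen : ParaHilbert.IsGeneralizedInverse A B) :
    ParaHilbert.IsPseudoinverse A B ↔
      (ParaHilbert.IsAdjointPair (A.comp B) (A.comp B) ∧
        ParaHilbert.IsAdjointPair (B.comp A) (B.comp A)) := by
  rw [ParaHilbert.isAdjointPair_self_iff, ParaHilbert.isAdjointPair_self_iff]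
  exact and_iff_right hgen

end Statements
end

section
/- Let E₁ and E₂ be reflexive para-Hilbert spaces and let A : E₁ → E₂ be a surjective morphism (each component A_X, A_H, A_Y is surjective). Then A admits a pseudoinverse if and only if the continuous linear block operator M : X₁ × Y₂* → Y₁* × X₂, defined by M(u, λ) := (J₁ u + (A_Y)ᵗ λ, A_X u) (where (A_Y)ᵗ : Y₂* → Y₁* is the transpose of A_Y), is a continuous linear isomorphism of Banach spaces. -/
open scoped RealInnerProductSpace

section Statements

variable {X₁ H₁ Y₁ X₂ H₂ Y₂ : Type*}
  [NormedAddCommGroup X₁] [NormedSpace ℝ X₁] [CompleteSpace X₁]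
  [NormedAddCommGroup H₁] [InnerProductSpace ℝ H₁] [CompleteSpace H₁]
  [NormedAddCommGroup Y₁] [NormedSpace ℝ Y₁] [CompleteSpace Y₁]
  [NormedAddCommGroup X₂] [NormedSpace ℝ X₂] [CompleteSpace X₂]
  [NormedAddCommGroup H₂] [InnerProductSpace ℝ H₂] [CompleteSpace H₂]
  [NormedAddCommGroup Y₂] [NormedSpace ℝ Y₂] [CompleteSpace Y₂]

variable {E₁ : ParaHilbert X₁ H₁ Y₁} {E₂ : ParaHilbert X₂ H₂ Y₂}

/-- The saddle point operator `M : X₁ × Y₂* → Y₁* × X₂`,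
`M(u, λ) = (J₁ u + (A_Y)ᵗ λ, A_X u)`. -/
noncomputable def Msaddle (A : E₁.Hom E₂) :
    (X₁ × (Y₂ →L[ℝ] ℝ)) →L[ℝ] ((Y₁ →L[ℝ] ℝ) × X₂) :=
  ((E₁.J : X₁ →L[ℝ] (Y₁ →L[ℝ] ℝ)).comp (ContinuousLinearMap.fst ℝ X₁ (Y₂ →L[ℝ] ℝ)) +
      (transposeCLM A.AY).comp (ContinuousLinearMap.snd ℝ X₁ (Y₂ →L[ℝ] ℝ))).prod
    (A.AX.comp (ContinuousLinearMap.fst ℝ X₁ (Y₂ →L[ℝ] ℝ)))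

theorem ReflexiveBanach.exists_predual {V W : Type*}
    [NormedAddCommGroup V] [NormedSpace ℝ V] [NormedAddCommGroup W] [NormedSpace ℝ W]
    (hV : ReflexiveBanach V) (S : (V →L[ℝ] ℝ) →L[ℝ] (W →L[ℝ] ℝ)) :
    ∃ T : W →L[ℝ] V, ∀ (f : V →L[ℝ] ℝ) (w : W), f (T w) = S f w := by
  let e : V ≃ₗᵢ[ℝ] StrongDual ℝ (StrongDual ℝ V) :=
    LinearIsometryEquiv.ofSurjective (NormedSpace.inclusionInDoubleDualLi ℝ) hV
  refine ⟨(e.symm.toContinuousLinearEquiv : _ →L[ℝ] V).comp S.flip, fun f w => ?_⟩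
  exact congrArg (fun φ : StrongDual ℝ (StrongDual ℝ V) => φ f) (e.apply_symm_apply (S.flip w))

/-- A surjective operator between Hilbert spaces has a bounded right inverse with values in the
orthogonal complement of its kernel. -/
theorem ContinuousLinearMap.exists_rightInverse_orthogonal_ker {H K : Type*}
    [NormedAddCommGroup H] [InnerProductSpace ℝ H] [CompleteSpace H]
    [NormedAddCommGroup K] [InnerProductSpace ℝ K] [CompleteSpace K]
    (T : H →L[ℝ] K) (hT : Function.Surjective T) :
    ∃ R : K →L[ℝ] H, (∀ v, T (R v) = v) ∧ ∀ v w, T w = 0 → ⟪w, R v⟫ = 0 := by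
  let N : Submodule ℝ H := T.ker
  have : CompleteSpace N := T.isClosed_ker.completeSpace_coe
  let T' : Nᗮ →L[ℝ] K := T.comp Nᗮ.subtypeL
  have hker : T'.ker = ⊥ := by
    refine LinearMap.ker_eq_bot'.2 fun x hx => Subtype.ext ?_
    have hxN : (x : H) ∈ N := hx
    exact inner_self_eq_zero.1 (Submodule.inner_right_of_mem_orthogonal hxN x.2)
  have hrange : T'.range = ⊤ := by
    refine LinearMap.range_eq_top.2 fun v => ?_
    obtain ⟨w, rfl⟩ := hT v
    obtain ⟨y, hy, z, hz, rfl⟩ := N.exists_add_mem_mem_orthogonal w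
    refine ⟨⟨z, hz⟩, ?_⟩
    have hy' : T y = 0 := hy
    simp [T', hy']
  let e := ContinuousLinearEquiv.ofBijective T' hker hrange
  refine ⟨Nᗮ.subtypeL.comp (e.symm : K →L[ℝ] Nᗮ), fun v => e.apply_symm_apply v, ?_⟩
  intro v w hw
  exact Submodule.inner_right_of_mem_orthogonal (K := N) hw (e.symm v).2

theorem isSelfAdjointOp_comp_of_rightInverse {H K : Type*}
    [NormedAddCommGroup H] [InnerProductSpace ℝ H]
    [NormedAddCommGroup K] [InnerProductSpace ℝ K]
    {T : H →L[ℝ] K} {R : K →L[ℝ] H} (hTR : ∀ v, T (R v) = v)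
    (horth : ∀ v w, T w = 0 → ⟪w, R v⟫ = 0) : IsSelfAdjointOp (R.comp T) := by
  intro v w
  have key : ∀ a b : H, ⟪a, R (T b)⟫ = ⟪R (T a), R (T b)⟫ := fun a b => by
    have := horth (T b) (a - R (T a)) (by simp [hTR])
    rwa [inner_sub_left, sub_eq_zero] at this
  simp only [ContinuousLinearMap.comp_apply]
  rw [key v w, real_inner_comm, key w v, real_inner_comm]

theorem ParaHilbert.Hom.ext_components {X₁ H₁ Y₁ X₂ H₂ Y₂ : Type*}
    [NormedAddCommGroup X₁] [NormedSpace ℝ X₁]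
    [NormedAddCommGroup H₁] [InnerProductSpace ℝ H₁]
    [NormedAddCommGroup Y₁] [NormedSpace ℝ Y₁]
    [NormedAddCommGroup X₂] [NormedSpace ℝ X₂]
    [NormedAddCommGroup H₂] [InnerProductSpace ℝ H₂]
    [NormedAddCommGroup Y₂] [NormedSpace ℝ Y₂]
    {E₁ : ParaHilbert X₁ H₁ Y₁} {E₂ : ParaHilbert X₂ H₂ Y₂} {A B : E₁.Hom E₂}
    (hX : ∀ x, A.AX x = B.AX x) (hH : ∀ v, A.AH v = B.AH v) (hY : ∀ y, A.AY y = B.AY y) :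
    A = B := by
  cases A
  cases B
  congr 1
  exacts [ContinuousLinearMap.ext hX, ContinuousLinearMap.ext hH, ContinuousLinearMap.ext hY]

/-- An endomorphism that is self-adjoint on `H` is self-adjoint for the pairing of `X` with `Y`. -/
theorem ParaHilbert.Hom.J_apply_of_isSelfAdjointOp {X H Y : Type*}
    [NormedAddCommGroup X] [NormedSpace ℝ X]
    [NormedAddCommGroup H] [InnerProductSpace ℝ H]
    [NormedAddCommGroup Y] [NormedSpace ℝ Y]
    {E : ParaHilbert X H Y} (P : E.Hom E) (hP : IsSelfAdjointOp P.AH) (x : X) (y : Y) :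
    E.J (P.AX x) y = E.J x (P.AY y) := by
  revert y
  refine congrFun (E.j_dense.equalizer (E.J (P.AX x)).continuous
    ((E.J x).comp P.AY).continuous (funext fun v => ?_))
  simp only [Function.comp_apply]
  rw [E.compat, P.comm_i, hP, ← P.comm_j, E.compat]

theorem Msaddle_apply (A : E₁.Hom E₂) (u : X₁) (l : Y₂ →L[ℝ] ℝ) :
    Msaddle A (u, l) = (E₁.J u + l.comp A.AY, A.AX u) := rfl

theorem ParaHilbert.IsPseudoinverse.bijective_Msaddle {A : E₁.Hom E₂} {B : E₂.Hom E₁}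
    (hB : ParaHilbert.IsPseudoinverse A B) (hsX : Function.Surjective A.AX)
    (hsY : Function.Surjective A.AY) : Function.Bijective (Msaddle A) := by
  obtain ⟨⟨hABA, -⟩, -, hself⟩ := hB
  have hX : ∀ w, A.AX (B.AX w) = w := fun w => by
    obtain ⟨x, rfl⟩ := hsX w
    exact congrArg (fun C : E₁.Hom E₂ => C.AX x) hABA
  have hY : ∀ w, A.AY (B.AY w) = w := fun w => by
    obtain ⟨y, rfl⟩ := hsY w
    exact congrArg (fun C : E₁.Hom E₂ => C.AY y) hABA
  have hJ : ∀ x y, E₁.J (B.AX (A.AX x)) y = E₁.J x (B.AY (A.AY y)) :=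
    (B.comp A).J_apply_of_isSelfAdjointOp hself
  constructor
  · refine (injective_iff_map_eq_zero (Msaddle A)).2 ?_
    rintro ⟨u, l⟩ h
    rw [Msaddle_apply, Prod.mk_eq_zero] at h
    obtain ⟨h1, h2⟩ := h
    have hl : l = 0 := by
      ext z
      have := congrArg (fun f : Y₁ →L[ℝ] ℝ => f (B.AY z)) h1
      have h3 := hJ u (B.AY z)
      rw [h2, hY] at h3
      simpa [hY, ← h3] using this
    subst hl
    have hu : E₁.J u = 0 := by simpa using h1
    simpa using hu
  · rintro ⟨f, w⟩
    obtain ⟨a, rfl⟩ := E₁.J.surjective f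
    refine ⟨(B.AX w + (a - B.AX (A.AX a)), (E₁.J (a - B.AX w)).comp B.AY), ?_⟩
    rw [Msaddle_apply]
    refine Prod.ext (ContinuousLinearMap.ext fun y => ?_) (by simp [hX])
    have h := hJ (a - B.AX w) y
    simp only [add_apply, ContinuousLinearMap.comp_apply]
    rw [← h]
    simp only [map_sub, map_add, hX, sub_apply, add_apply]
    ring

theorem exists_isPseudoinverse_of_bijective_Msaddle (hrefl₁ : ReflexiveBanach Y₁)
    (A : E₁.Hom E₂) (hsH : Function.Surjective A.AH) (hM : Function.Bijective (Msaddle A)) :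
    ∃ B : E₂.Hom E₁, ParaHilbert.IsPseudoinverse A B := by
  let e := ContinuousLinearEquiv.ofBijective (Msaddle A)
    (LinearMap.ker_eq_bot.2 hM.1) (LinearMap.range_eq_top.2 hM.2)
  have he : ∀ f w, E₁.J (e.symm (f, w)).1 + (e.symm (f, w)).2.comp A.AY = f ∧
      A.AX (e.symm (f, w)).1 = w := fun f w =>
    Prod.ext_iff.1 (e.apply_symm_apply (f, w))
  obtain ⟨R, hAR, horth⟩ := A.AH.exists_rightInverse_orthogonal_ker hsH
  let BX : X₂ →L[ℝ] X₁ := (ContinuousLinearMap.fst ℝ X₁ (Y₂ →L[ℝ] ℝ)).comp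
    ((e.symm : _ →L[ℝ] _).comp (ContinuousLinearMap.inr ℝ (Y₁ →L[ℝ] ℝ) X₂))
  let S : (Y₁ →L[ℝ] ℝ) →L[ℝ] (Y₂ →L[ℝ] ℝ) := (ContinuousLinearMap.snd ℝ X₁ (Y₂ →L[ℝ] ℝ)).comp
    ((e.symm : _ →L[ℝ] _).comp (ContinuousLinearMap.inl ℝ (Y₁ →L[ℝ] ℝ) X₂))
  obtain ⟨BY, hBY⟩ := hrefl₁.exists_predual S
  have hAX : ∀ w, A.AX (BX w) = w := fun w => (he 0 w).2
  have hAY : ∀ y, A.AY (BY y) = y := fun y => by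
    refine (SeparatingDual.eq_iff_forall_dual_eq (R := ℝ)).2 fun l => ?_
    have hS : e.symm (l.comp A.AY, 0) = (0, l) := by
      refine e.symm_apply_eq.2 (Eq.symm ?_)
      exact (Msaddle_apply A 0 l).trans (by simp)
    have := hBY (l.comp A.AY) y
    change l (A.AY (BY y)) = (e.symm (l.comp A.AY, 0)).2 y at this
    rw [this, hS]
  let B : E₂.Hom E₁ :=
    { AX := BX
      AH := R
      AY := BY
      comm_i := fun w => by
        obtain ⟨h1, -⟩ := he 0 w
        change E₁.J (BX w) + _ = 0 at h1
        have hperp : ∀ v, A.AH v = 0 → ⟪E₁.i (BX w), v⟫ = 0 := fun v hv => by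
          have := congrArg (fun f : Y₁ →L[ℝ] ℝ => f (E₁.j v)) h1
          simpa [E₁.compat, ← A.comm_j, hv] using this
        have hd : A.AH (E₁.i (BX w) - R (E₂.i w)) = 0 := by
          rw [map_sub, ← A.comm_i, hAX, hAR, sub_self]
        refine sub_eq_zero.1 (inner_self_eq_zero (𝕜 := ℝ).1 ?_)
        conv_lhs => rw [inner_sub_right]
        rw [real_inner_comm, hperp _ hd, horth _ _ hd, sub_zero]
      comm_j := fun v => by
        refine (SeparatingDual.eq_iff_forall_dual_eq (R := ℝ)).2 fun f => ?_
        obtain ⟨h1, h2⟩ := he f 0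
        have hu : A.AH (E₁.i (e.symm (f, 0)).1) = 0 := by rw [← A.comm_i, h2, map_zero]
        have h := congrArg (fun g : Y₁ →L[ℝ] ℝ => g (E₁.j (R v))) h1
        simp only [add_apply, ContinuousLinearMap.comp_apply,
          E₁.compat, horth _ _ hu, ← A.comm_j, hAR, zero_add] at h
        rw [hBY, ← h]
        rfl }
  refine ⟨B, ⟨ParaHilbert.Hom.ext_components (fun x => hAX _) (fun v => hAR _) fun y => hAY _,
    ParaHilbert.Hom.ext_components (fun x => congrArg BX (hAX x)) (fun v => congrArg R (hAR v))
      fun y => congrArg BY (hAY y)⟩, fun v w => ?_, isSelfAdjointOp_comp_of_rightInverse hAR horth⟩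
  change ⟪A.AH (R v), w⟫ = ⟪v, A.AH (R w)⟫
  rw [hAR, hAR]

/-- Let `E₁`, `E₂` be reflexive para-Hilbert spaces and `A : E₁ → E₂` a surjective
morphism. Then `A` admits a pseudoinverse if and only if the saddle point operator
`M(u, λ) = (J₁ u + (A_Y)ᵗ λ, A_X u)` is a continuous linear isomorphism. -/
theorem statement10 (E₁ : ParaHilbert X₁ H₁ Y₁) (E₂ : ParaHilbert X₂ H₂ Y₂)
    (hrefl₁ : ReflexiveBanach Y₁) (hrefl₂ : ReflexiveBanach Y₂)
    (A : E₁.Hom E₂) (hsX : Function.Surjective A.AX) (hsH : Function.Surjective A.AH)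
    (hsY : Function.Surjective A.AY) :
    (∃ B : E₂.Hom E₁, ParaHilbert.IsPseudoinverse A B) ↔
      Function.Bijective (Msaddle A) := by
  exact ⟨fun ⟨_, hB⟩ => hB.bijective_Msaddle hsX hsY,
    exists_isPseudoinverse_of_bijective_Msaddle hrefl₁ A hsH⟩

end Statements
end

section
/- Let E₁ and E₂ be reflexive para-Hilbert spaces and let A : E₁ → E₂ be a surjective morphism (each component surjective). Then the block operator M : X₁ × Y₂* → Y₁* × X₂, M(u, λ) := (J₁ u + (A_Y)ᵗ λ, A_X u), is a continuous linear isomorphism if and only if the block operator N : Y₁ × X₂* → X₁* × Y₂, N(w, μ) := (K₁ w + (A_X)ᵗ μ, A_Y w), is a continuous linear isomorphism, where K_k := (J_k)ᵗ ∘ Ψ_{Y_k} : Y_k → X_k* and Ψ_{Y_k} : Y_k → Y_k** is the canonical embedding. -/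
open scoped RealInnerProductSpace

section Statements

variable {X₁ H₁ Y₁ X₂ H₂ Y₂ : Type*}
  [NormedAddCommGroup X₁] [NormedSpace ℝ X₁] [CompleteSpace X₁]
  [NormedAddCommGroup H₁] [InnerProductSpace ℝ H₁] [CompleteSpace H₁]
  [NormedAddCommGroup Y₁] [NormedSpace ℝ Y₁] [CompleteSpace Y₁]
  [NormedAddCommGroup X₂] [NormedSpace ℝ X₂] [CompleteSpace X₂]
  [NormedAddCommGroup H₂] [InnerProductSpace ℝ H₂] [CompleteSpace H₂]
  [NormedAddCommGroup Y₂] [NormedSpace ℝ Y₂] [CompleteSpace Y₂]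

variable {E₁ : ParaHilbert X₁ H₁ Y₁} {E₂ : ParaHilbert X₂ H₂ Y₂}

/-- The saddle point operator `N : Y₁ × X₂* → X₁* × Y₂`,
`N(w, μ) = (K₁ w + (A_X)ᵗ μ, A_Y w)`. -/
noncomputable def Nsaddle (A : E₁.Hom E₂) :
    (Y₁ × (X₂ →L[ℝ] ℝ)) →L[ℝ] ((X₁ →L[ℝ] ℝ) × Y₂) :=
  ((Kmap E₁).comp (ContinuousLinearMap.fst ℝ Y₁ (X₂ →L[ℝ] ℝ)) +
      (transposeCLM A.AX).comp (ContinuousLinearMap.snd ℝ Y₁ (X₂ →L[ℝ] ℝ))).prod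
    (A.AY.comp (ContinuousLinearMap.fst ℝ Y₁ (X₂ →L[ℝ] ℝ)))

section Duality

open NormedSpace

/-- If `N` is adjoint to the continuous linear bijection `M` for a pairing `b` that identifies `V'`
with the dual of `W` and a pairing `c` that embeds `W'` in the dual of `V`, then `N` is bijective. -/
lemma bijective_of_bijective_adjoint {V W V' W' : Type*}
    [NormedAddCommGroup V] [NormedSpace ℝ V] [CompleteSpace V]
    [NormedAddCommGroup W] [NormedSpace ℝ W] [CompleteSpace W]
    {M : V →L[ℝ] W} {N : V' → W'} {b : V' → (W →L[ℝ] ℝ)} {c : W' → (V →L[ℝ] ℝ)}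
    (hb : Function.Bijective b) (hc : Function.Injective c)
    (h : ∀ v' v, c (N v') v = b v' (M v)) (hM : Function.Bijective M) :
    Function.Bijective N := by
  refine ⟨fun x y hxy => hb.1 ?_, fun w' => ?_⟩
  · ext w
    obtain ⟨v, rfl⟩ := hM.2 w
    rw [← h, ← h, hxy]
  · let e : V ≃L[ℝ] W := ContinuousLinearEquiv.ofBijective M
      (LinearMap.ker_eq_bot.2 hM.1) (LinearMap.range_eq_top.2 hM.2)
    obtain ⟨v', hv'⟩ := hb.2 ((c w').comp (e.symm : W →L[ℝ] V))
    refine ⟨v', hc ?_⟩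
    ext v
    rw [h, hv']
    exact congrArg (c w') (e.symm_apply_apply v)

/-- Injections into the duals of `P` and `Q` give an injection into the dual of `P × Q`. -/
lemma coprod_injective {S T P Q : Type*} [NormedAddCommGroup P] [NormedSpace ℝ P]
    [NormedAddCommGroup Q] [NormedSpace ℝ Q] {f : S → (P →L[ℝ] ℝ)} {g : T → (Q →L[ℝ] ℝ)}
    (hf : Function.Injective f) (hg : Function.Injective g) :
    Function.Injective fun p : S × T => (f p.1).coprod (g p.2) := by
  rintro ⟨s, t⟩ ⟨s', t'⟩ h
  refine Prod.ext (hf ?_) (hg ?_)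
  · ext p
    simpa using DFunLike.congr_fun h (p, 0)
  · ext q
    simpa using DFunLike.congr_fun h (0, q)

/-- Surjections onto the duals of `P` and `Q` give a surjection onto the dual of `P × Q`. -/
lemma coprod_surjective {S T P Q : Type*} [NormedAddCommGroup P] [NormedSpace ℝ P]
    [NormedAddCommGroup Q] [NormedSpace ℝ Q] {f : S → (P →L[ℝ] ℝ)} {g : T → (Q →L[ℝ] ℝ)}
    (hf : Function.Surjective f) (hg : Function.Surjective g) :
    Function.Surjective fun p : S × T => (f p.1).coprod (g p.2) := by
  intro φ
  obtain ⟨s, hs⟩ := hf (φ.comp (ContinuousLinearMap.inl ℝ P Q))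
  obtain ⟨t, ht⟩ := hg (φ.comp (ContinuousLinearMap.inr ℝ P Q))
  refine ⟨(s, t), ?_⟩
  ext <;> simp [hs, ht]

lemma inclusionInDoubleDual_injective (E : Type*) [NormedAddCommGroup E] [NormedSpace ℝ E] :
    Function.Injective (inclusionInDoubleDual ℝ E) :=
  (inclusionInDoubleDualLi ℝ (E := E)).injective

end Duality

section Reflexive

variable {X H Y : Type*}
  [NormedAddCommGroup X] [NormedSpace ℝ X]
  [NormedAddCommGroup H] [InnerProductSpace ℝ H]
  [NormedAddCommGroup Y] [NormedSpace ℝ Y]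

lemma Kmap_apply (E : ParaHilbert X H Y) (w : Y) (x : X) : Kmap E w x = E.J x w := rfl

/-- If `Y` is reflexive, then so is `X`. -/
lemma ParaHilbert.reflexiveBanach_left (E : ParaHilbert X H Y) (hY : ReflexiveBanach Y) :
    ReflexiveBanach X := by
  intro φ
  obtain ⟨u, hu⟩ := E.J.surjective (φ.comp (Kmap E))
  refine ⟨u, ?_⟩
  ext f
  obtain ⟨w, hw⟩ := hY (f.comp (E.J.symm : (Y →L[ℝ] ℝ) →L[ℝ] X))
  have hK : Kmap E w = f := by
    ext x
    simpa [Kmap_apply] using DFunLike.congr_fun hw (E.J x)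
  have hφ : E.J u w = φ (Kmap E w) := DFunLike.congr_fun hu w
  rw [← hK, ← hφ]
  rfl

end Reflexive

/-- Let `E₁`, `E₂` be reflexive para-Hilbert spaces and `A : E₁ → E₂` a surjective
morphism. Then the saddle point operator `M(u, λ) = (J₁ u + (A_Y)ᵗ λ, A_X u)` is a
continuous linear isomorphism if and only if the saddle point operator
`N(w, μ) = (K₁ w + (A_X)ᵗ μ, A_Y w)` is one. -/
theorem statement11 (E₁ : ParaHilbert X₁ H₁ Y₁) (E₂ : ParaHilbert X₂ H₂ Y₂)
    (hrefl₁ : ReflexiveBanach Y₁) (hrefl₂ : ReflexiveBanach Y₂)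
    (A : E₁.Hom E₂) (hsX : Function.Surjective A.AX) (hsH : Function.Surjective A.AH)
    (hsY : Function.Surjective A.AY) :
    Function.Bijective (Msaddle A) ↔ Function.Bijective (Nsaddle A) := by
  have hN (w : Y₁) (μ : X₂ →L[ℝ] ℝ) :
      Nsaddle A (w, μ) = (Kmap E₁ w + transposeCLM A.AX μ, A.AY w) := rfl
  have hM (u : X₁) (l : Y₂ →L[ℝ] ℝ) :
      Msaddle A (u, l) = (E₁.J u + transposeCLM A.AY l, A.AX u) := rfl
  have hX (μ : X₂ →L[ℝ] ℝ) (u : X₁) : transposeCLM A.AX μ u = μ (A.AX u) := rfl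
  have hY (l : Y₂ →L[ℝ] ℝ) (w : Y₁) : transposeCLM A.AY l w = l (A.AY w) := rfl
  have hrefl : ReflexiveBanach X₁ := E₁.reflexiveBanach_left hrefl₁
  constructor
  · refine bijective_of_bijective_adjoint
      (b := fun p => (NormedSpace.inclusionInDoubleDual ℝ Y₁ p.1).coprod p.2)
      (c := fun p => p.1.coprod (NormedSpace.inclusionInDoubleDual ℝ Y₂ p.2))
      ⟨coprod_injective (inclusionInDoubleDual_injective Y₁) Function.injective_id,
        coprod_surjective hrefl₁ Function.surjective_id⟩
      (coprod_injective Function.injective_id (inclusionInDoubleDual_injective Y₂)) ?_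
    rintro ⟨w, μ⟩ ⟨u, l⟩
    simp only [hN, hM, ContinuousLinearMap.coprod_apply, add_apply,
      NormedSpace.dual_def, Kmap_apply, hX, hY]
    ring
  · refine bijective_of_bijective_adjoint
      (b := fun p => (NormedSpace.inclusionInDoubleDual ℝ X₁ p.1).coprod p.2)
      (c := fun p => p.1.coprod (NormedSpace.inclusionInDoubleDual ℝ X₂ p.2))
      ⟨coprod_injective (inclusionInDoubleDual_injective X₁) Function.injective_id,
        coprod_surjective hrefl Function.surjective_id⟩
      (coprod_injective Function.injective_id (inclusionInDoubleDual_injective X₂)) ?_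
    rintro ⟨u, l⟩ ⟨w, μ⟩
    simp only [hN, hM, ContinuousLinearMap.coprod_apply, add_apply,
      NormedSpace.dual_def, Kmap_apply, hX, hY]
    ring

end Statements
end

section
/- Let E₁ be a reflexive para-Hilbert space, let E₂ be a para-Hilbert space whose spaces X₂, H₂, Y₂ are finite-dimensional, and let A : E₁ → E₂ be a surjective morphism (each component surjective) that admits a right-inverse morphism B : E₂ → E₁ (A B = id_{E₂}). Then A admits a pseudoinverse. -/
open scoped RealInnerProductSpace

section Helpers

variable {X₁ H₁ Y₁ X₂ H₂ Y₂ : Type*}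
  [NormedAddCommGroup X₁] [NormedSpace ℝ X₁]
  [NormedAddCommGroup H₁] [InnerProductSpace ℝ H₁]
  [NormedAddCommGroup Y₁] [NormedSpace ℝ Y₁]
  [NormedAddCommGroup X₂] [NormedSpace ℝ X₂]
  [NormedAddCommGroup H₂] [InnerProductSpace ℝ H₂]
  [NormedAddCommGroup Y₂] [NormedSpace ℝ Y₂]

/-- A linear map with dense range into a finite-dimensional space is surjective. -/
theorem LinearMap.surjective_of_denseRange_of_finiteDimensional {E F : Type*}
    [AddCommGroup E] [Module ℝ E] [NormedAddCommGroup F] [NormedSpace ℝ F]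
    [FiniteDimensional ℝ F] (f : E →ₗ[ℝ] F) (hf : DenseRange f) : Function.Surjective f := by
  rw [← Set.range_eq_univ, ← hf.closure_range, ← LinearMap.coe_range]
  exact (Submodule.closed_of_finiteDimensional f.range).closure_eq.symm

/-- For a surjective operator `T` between Hilbert spaces, `T T*` is injective. -/
theorem ContinuousLinearMap.injective_comp_adjoint_of_surjective [CompleteSpace H₁]
    [CompleteSpace H₂] (T : H₁ →L[ℝ] H₂) (hT : Function.Surjective T) :
    Function.Injective (T ∘L ContinuousLinearMap.adjoint T) := by
  rw [injective_iff_map_eq_zero]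
  intro v hv
  have h0 : ContinuousLinearMap.adjoint T v = 0 := by
    rw [← inner_self_eq_zero (𝕜 := ℝ), ContinuousLinearMap.adjoint_inner_left]
    change ⟪v, (T ∘L ContinuousLinearMap.adjoint T) v⟫ = 0
    rw [hv, inner_zero_right]
  obtain ⟨w, rfl⟩ := hT v
  rw [← inner_self_eq_zero (𝕜 := ℝ), ← ContinuousLinearMap.adjoint_inner_left, h0,
    inner_zero_left]

namespace ParaHilbert

/-- The adjoint of the Hilbert component of a morphism lifts to the `X` components. -/
theorem Hom.adjoint_comm_i [CompleteSpace H₁] [CompleteSpace H₂]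
    {E₁ : ParaHilbert X₁ H₁ Y₁} {E₂ : ParaHilbert X₂ H₂ Y₂} (A : E₁.Hom E₂) (u : X₂) :
    E₁.i (E₁.J.symm ((E₂.J u).comp A.AY)) = ContinuousLinearMap.adjoint A.AH (E₂.i u) := by
  refine ext_inner_right ℝ fun w => ?_
  rw [← E₁.compat, E₁.J.apply_symm_apply, ContinuousLinearMap.adjoint_inner_left, ← E₂.compat,
    A.comm_j, ContinuousLinearMap.comp_apply]

theorem isPseudoinverse_of_rightInverse {E₁ : ParaHilbert X₁ H₁ Y₁} {E₂ : ParaHilbert X₂ H₂ Y₂}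
    {A : E₁.Hom E₂} {P : E₂.Hom E₁} (hP : A.comp P = Hom.id E₂)
    (hsa : IsSelfAdjointOp (P.AH.comp A.AH)) : IsPseudoinverse A P := by
  refine ⟨⟨?_, ?_⟩, ?_, hsa⟩
  · change (A.comp P).comp A = A
    rw [hP]; rfl
  · rw [hP]; rfl
  · have h : A.AH.comp P.AH = ContinuousLinearMap.id ℝ H₂ := congrArg Hom.AH hP
    rw [h]
    exact fun _ _ => rfl

/-- A morphism onto a finite-dimensional para-Hilbert space which is surjective on the Hilbert
components has a pseudoinverse, with Hilbert component `A* (A A*)⁻¹`. -/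
theorem exists_isPseudoinverse_of_surjective [CompleteSpace H₁] [CompleteSpace H₂]
    [FiniteDimensional ℝ X₂] [FiniteDimensional ℝ H₂] [FiniteDimensional ℝ Y₂]
    {E₁ : ParaHilbert X₁ H₁ Y₁} {E₂ : ParaHilbert X₂ H₂ Y₂} (A : E₁.Hom E₂)
    (hA : Function.Surjective A.AH) : ∃ P : E₂.Hom E₁, IsPseudoinverse A P := by
  set T := ContinuousLinearMap.adjoint A.AH with hT
  have hinj : Function.Injective (A.AH ∘L T).toLinearMap :=
    A.AH.injective_comp_adjoint_of_surjective hA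
  let S : H₂ ≃ₗ[ℝ] H₂ := LinearEquiv.ofInjectiveEndo _ hinj
  have hS : ∀ v, A.AH (T (S.symm v)) = v := fun v => S.apply_symm_apply v
  let eI : X₂ ≃ₗ[ℝ] H₂ := LinearEquiv.ofBijective E₂.i.toLinearMap
    ⟨E₂.i_inj, LinearMap.surjective_of_denseRange_of_finiteDimensional _ E₂.i_dense⟩
  let eJ : H₂ ≃ₗ[ℝ] Y₂ := LinearEquiv.ofBijective E₂.j.toLinearMap
    ⟨E₂.j_inj, LinearMap.surjective_of_denseRange_of_finiteDimensional _ E₂.j_dense⟩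
  have hI : ∀ v, E₂.i (eI.symm v) = v := fun v => eI.apply_symm_apply v
  have hJ : ∀ v, eJ.symm (E₂.j v) = v := fun v => eJ.symm_apply_apply v
  have hJ' : ∀ y, E₂.j (eJ.symm y) = y := fun y => eJ.apply_symm_apply y
  let PH : H₂ →L[ℝ] H₁ := T ∘L LinearMap.toContinuousLinearMap S.symm.toLinearMap
  let PX : X₂ →L[ℝ] X₁ :=
    (E₁.J.symm : (Y₁ →L[ℝ] ℝ) →L[ℝ] X₁) ∘L transposeCLM A.AY ∘L
      (E₂.J : X₂ →L[ℝ] (Y₂ →L[ℝ] ℝ)) ∘L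
      LinearMap.toContinuousLinearMap (eI.trans (S.symm.trans eI.symm)).toLinearMap
  let PY : Y₂ →L[ℝ] Y₁ := E₁.j ∘L PH ∘L LinearMap.toContinuousLinearMap eJ.symm.toLinearMap
  have hPH : ∀ v, A.AH (PH v) = v := hS
  have hPX : ∀ u, E₁.i (PX u) = PH (E₂.i u) := fun u => by
    change E₁.i (E₁.J.symm ((E₂.J (eI.symm (S.symm (E₂.i u)))).comp A.AY)) = T (S.symm (E₂.i u))
    rw [A.adjoint_comm_i, hI]
  let P : E₂.Hom E₁ :=
    { AX := PX
      AH := PH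
      AY := PY
      comm_i := hPX
      comm_j := fun v => by
        change E₁.j (PH v) = E₁.j (PH (eJ.symm (E₂.j v)))
        rw [hJ] }
  refine ⟨P, isPseudoinverse_of_rightInverse ?_ ?_⟩
  · have hX : A.AX.comp PX = ContinuousLinearMap.id ℝ X₂ := by
      ext u
      apply E₂.i_inj
      rw [ContinuousLinearMap.comp_apply, A.comm_i, hPX, hPH]; rfl
    have hH : A.AH.comp PH = ContinuousLinearMap.id ℝ H₂ := by
      ext v
      exact hPH v
    have hY : A.AY.comp PY = ContinuousLinearMap.id ℝ Y₂ := by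
      ext y
      change A.AY (E₁.j (PH (eJ.symm y))) = y
      rw [← A.comm_j, hPH, hJ']
    simp only [Hom.comp, Hom.id, P, hX, hH, hY]
  · intro v w
    obtain ⟨a, ha⟩ : ∃ a, S a = A.AH v := S.surjective _
    obtain ⟨b, hb⟩ : ∃ b, S b = A.AH w := S.surjective _
    have h1 : PH (A.AH v) = T a := by
      change T (S.symm (A.AH v)) = T a
      rw [← ha, S.symm_apply_apply]
    have h2 : PH (A.AH w) = T b := by
      change T (S.symm (A.AH w)) = T b
      rw [← hb, S.symm_apply_apply]
    change ⟪PH (A.AH v), w⟫ = ⟪v, PH (A.AH w)⟫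
    rw [h1, h2, hT, ContinuousLinearMap.adjoint_inner_left, ContinuousLinearMap.adjoint_inner_right,
      ← ha, ← hb]
    change ⟪a, A.AH (T b)⟫ = ⟪A.AH (T a), b⟫
    rw [← ContinuousLinearMap.adjoint_inner_left A.AH, ← ContinuousLinearMap.adjoint_inner_right A.AH]

end ParaHilbert

end Helpers

section Statements

variable {X₁ H₁ Y₁ X₂ H₂ Y₂ : Type*}
  [NormedAddCommGroup X₁] [NormedSpace ℝ X₁] [CompleteSpace X₁]
  [NormedAddCommGroup H₁] [InnerProductSpace ℝ H₁] [CompleteSpace H₁]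
  [NormedAddCommGroup Y₁] [NormedSpace ℝ Y₁] [CompleteSpace Y₁]
  [NormedAddCommGroup X₂] [NormedSpace ℝ X₂] [CompleteSpace X₂]
  [NormedAddCommGroup H₂] [InnerProductSpace ℝ H₂] [CompleteSpace H₂]
  [NormedAddCommGroup Y₂] [NormedSpace ℝ Y₂] [CompleteSpace Y₂]

/-- Let `E₁` be a reflexive para-Hilbert space, let `E₂` be a finite-dimensional
para-Hilbert space, and let `A : E₁ → E₂` be a surjective morphism admitting a right
inverse morphism `B`. Then `A` admits a pseudoinverse. -/
theorem statement14 (E₁ : ParaHilbert X₁ H₁ Y₁) (E₂ : ParaHilbert X₂ H₂ Y₂)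
    [FiniteDimensional ℝ X₂] [FiniteDimensional ℝ H₂] [FiniteDimensional ℝ Y₂]
    (hrefl₁ : ReflexiveBanach Y₁)
    (A : E₁.Hom E₂) (hsX : Function.Surjective A.AX) (hsH : Function.Surjective A.AH)
    (hsY : Function.Surjective A.AY)
    (B : E₂.Hom E₁) (hB : A.comp B = ParaHilbert.Hom.id E₂) :
    ∃ P : E₂.Hom E₁, ParaHilbert.IsPseudoinverse A P :=
  ParaHilbert.exists_isPseudoinverse_of_surjective A hsH

end Statements
end

section
/- Let E₁ and E₂ be reflexive para-Hilbert spaces and let A : E₁ → E₂ be a surjective morphism admitting a pseudoinverse A†. Then: (1) for every u₁ ∈ X₁, the element u := u₁ − A†_X (A_X u₁) (the g₁-orthogonal projection of u₁ onto ker A_X) satisfies A_X u = 0, and there exists a Lagrange multiplier λ ∈ Y₂* such that J₁ u + (A_Y)ᵗ λ = J₁ u₁; (2) for every u₂ ∈ X₂, there exists μ ∈ Y₂* such that J₁ (A†_X u₂) + (A_Y)ᵗ μ = 0 and A_X (A†_X u₂) = u₂. Here (A_Y)ᵗ : Y₂* → Y₁* denotes the transpose of A_Y. -/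
open scoped RealInnerProductSpace

section Pseudoinverse

variable {X₁ H₁ Y₁ X₂ H₂ Y₂ : Type*}
  [NormedAddCommGroup X₁] [NormedSpace ℝ X₁]
  [NormedAddCommGroup H₁] [InnerProductSpace ℝ H₁]
  [NormedAddCommGroup Y₁] [NormedSpace ℝ Y₁]
  [NormedAddCommGroup X₂] [NormedSpace ℝ X₂]
  [NormedAddCommGroup H₂] [InnerProductSpace ℝ H₂]
  [NormedAddCommGroup Y₂] [NormedSpace ℝ Y₂]

/-- Functionals represented by the range of a pseudoinverse are invariant under the projection
`P_Y ∘ A_Y`. -/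
theorem ParaHilbert.IsPseudoinverse.J_comp_comp {E₁ : ParaHilbert X₁ H₁ Y₁}
    {E₂ : ParaHilbert X₂ H₂ Y₂} {A : E₁.Hom E₂} {P : E₂.Hom E₁}
    (hP : ParaHilbert.IsPseudoinverse A P) (w : X₂) :
    ((E₁.J (P.AX w)).comp P.AY).comp A.AY = E₁.J (P.AX w) := by
  obtain ⟨⟨-, hPAP⟩, -, hself⟩ := hP
  have hw : P.AX (A.AX (P.AX w)) = P.AX w := congrArg (fun B => B.AX w) hPAP
  refine DFunLike.coe_injective
    (E₁.j_dense.equalizer (ContinuousLinearMap.continuous _) (ContinuousLinearMap.continuous _) ?_)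
  funext v
  have h := hself (E₁.i (P.AX w)) v
  simp only [ContinuousLinearMap.comp_apply, ← A.comm_i, ← P.comm_i, hw] at h
  simp only [Function.comp_apply, ContinuousLinearMap.comp_apply, ← A.comm_j, ← P.comm_j,
    E₁.compat, h]

end Pseudoinverse

section Statements

variable {X₁ H₁ Y₁ X₂ H₂ Y₂ : Type*}
  [NormedAddCommGroup X₁] [NormedSpace ℝ X₁] [CompleteSpace X₁]
  [NormedAddCommGroup H₁] [InnerProductSpace ℝ H₁] [CompleteSpace H₁]
  [NormedAddCommGroup Y₁] [NormedSpace ℝ Y₁] [CompleteSpace Y₁]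
  [NormedAddCommGroup X₂] [NormedSpace ℝ X₂] [CompleteSpace X₂]
  [NormedAddCommGroup H₂] [InnerProductSpace ℝ H₂] [CompleteSpace H₂]
  [NormedAddCommGroup Y₂] [NormedSpace ℝ Y₂] [CompleteSpace Y₂]

/-- Saddle point characterization of the projected gradient and of the pseudoinverse:
if `A : E₁ → E₂` is a surjective morphism of reflexive para-Hilbert spaces with
pseudoinverse `A†`, then (1) for every `u₁ ∈ X₁` the orthogonal projection
`u = u₁ − A†_X (A_X u₁)` of `u₁` onto `ker A_X` satisfies `A_X u = 0` and
`J₁ u + (A_Y)ᵗ λ = J₁ u₁` for some Lagrange multiplier `λ ∈ Y₂*`; and (2) for every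
`u₂ ∈ X₂` there is `μ ∈ Y₂*` with `J₁ (A†_X u₂) + (A_Y)ᵗ μ = 0` and
`A_X (A†_X u₂) = u₂`. -/
theorem statement15 (E₁ : ParaHilbert X₁ H₁ Y₁) (E₂ : ParaHilbert X₂ H₂ Y₂)
    (hrefl₁ : ReflexiveBanach Y₁) (hrefl₂ : ReflexiveBanach Y₂)
    (A : E₁.Hom E₂) (hsX : Function.Surjective A.AX) (hsH : Function.Surjective A.AH)
    (hsY : Function.Surjective A.AY)
    (P : E₂.Hom E₁) (hP : ParaHilbert.IsPseudoinverse A P) :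
    (∀ u₁ : X₁, A.AX (u₁ - P.AX (A.AX u₁)) = 0 ∧
      ∃ lam : Y₂ →L[ℝ] ℝ,
        E₁.J (u₁ - P.AX (A.AX u₁)) + lam.comp A.AY = E₁.J u₁) ∧
    (∀ u₂ : X₂, (∃ mu : Y₂ →L[ℝ] ℝ, E₁.J (P.AX u₂) + mu.comp A.AY = 0) ∧
      A.AX (P.AX u₂) = u₂) := by
  have hAP (w : X₂) : A.AX (P.AX w) = w := by
    obtain ⟨x, rfl⟩ := hsX w
    exact congrArg (fun B => B.AX x) hP.1.1
  refine ⟨fun u₁ => ⟨?_, (E₁.J (P.AX (A.AX u₁))).comp P.AY, ?_⟩,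
    fun u₂ => ⟨⟨-(E₁.J (P.AX u₂)).comp P.AY, ?_⟩, hAP u₂⟩⟩
  · rw [map_sub, hAP, sub_self]
  · rw [hP.J_comp_comp, map_sub, sub_add_cancel]
  · rw [ContinuousLinearMap.neg_comp, hP.J_comp_comp, add_neg_cancel]

end Statements
end
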